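/- Let X be a compact set in C^n, z_0 in X, and mu in J_{z_0}(X). Then there exists a measure nu in J_{z_0}^b(X) (i.e., nu in J_{z_0}(X) with supp nu contained in B_X) such that nu(u) >= mu(u) for every u in PSH^c(X). -/

import Mathlib

open MeasureTheory Metric Filter Topology Set Complex
open scoped ENNReal

noncomputable section

/-- `ℂⁿ`. -/
abbrev En (n : ℕ) : Type := EuclideanSpace ℂ (Fin n)

instance (n : ℕ) : MeasurableSpace (En n) := borel _

instance (n : ℕ) : BorelSpace (En n) := ⟨rfl⟩

open Classical in
/-- The positive part of an extended real number, as an element of `ℝ≥0∞`. -/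
def epos (x : EReal) : ℝ≥0∞ := if x = ⊤ then ⊤ else ENNReal.ofReal x.toReal

/-- The integral of an `EReal`-valued function `u` against a measure `μ`, defined as the
difference of the lower integrals of the positive and negative parts of `u`. -/
def eint {α : Type*} [MeasurableSpace α] (μ : Measure α) (u : α → EReal) : EReal :=
  ((∫⁻ x, epos (u x) ∂μ : ℝ≥0∞) : EReal) - ((∫⁻ x, epos (-(u x)) ∂μ : ℝ≥0∞) : EReal)

/-- The normalized angular measure `(2π)⁻¹ dθ` on `[0, 2π)`. -/
def thetaM : Measure ℝ :=
  (ENNReal.ofReal ((2 * Real.pi)⁻¹)) • (volume.restrict (Set.Ico (0 : ℝ) (2 * Real.pi)))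

/-- A function `u` with values in `[-∞, ∞)` is plurisubharmonic on an open set `U ⊆ ℂⁿ`:
it is upper semicontinuous, `< ⊤`, and satisfies the sub-mean-value inequality on every
complex line. -/
def PshOnE {n : ℕ} (u : En n → EReal) (U : Set (En n)) : Prop :=
  UpperSemicontinuousOn u U ∧ (∀ z ∈ U, u z < ⊤) ∧
  ∀ z ∈ U, ∀ w : En n, ∀ r : ℝ, 0 < r →
    (∀ ζ : ℂ, ‖ζ‖ ≤ r → z + ζ • w ∈ U) →
    u z ≤ eint thetaM (fun θ => u (z + (circleMap 0 r θ) • w))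

/-- `μ` is a Jensen measure on `X` with barycenter `z`:  a Borel probability measure
supported on `X` such that `u z ≤ ∫ u dμ` for every function `u` continuous and
plurisubharmonic on some open neighborhood of `X`. -/
def IsJensen {n : ℕ} (X : Set (En n)) (z : En n) (μ : Measure (En n)) : Prop :=
  IsProbabilityMeasure μ ∧ μ Xᶜ = 0 ∧
  ∀ U : Set (En n), IsOpen U → X ⊆ U →
    ∀ u : En n → EReal, ContinuousOn u U → PshOnE u U → u z ≤ eint μ u

/-- `u : X → [-∞, ∞)` is plurisubharmonic on the compact set `X` : it is upper
semicontinuous on `X`, `< ⊤` on `X`, and satisfies the subaveraging inequality with respect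
to all Jensen measures on `X`. -/
def PSHe {n : ℕ} (X : Set (En n)) (u : En n → EReal) : Prop :=
  UpperSemicontinuousOn u X ∧ (∀ z ∈ X, u z < ⊤) ∧
  ∀ z ∈ X, ∀ μ : Measure (En n), IsJensen X z μ → u z ≤ eint μ u

/-- `PSH^c(X)`: continuous plurisubharmonic functions on `X`. -/
def PSHce {n : ℕ} (X : Set (En n)) (u : En n → EReal) : Prop :=
  PSHe X u ∧ ContinuousOn u X

/-- Real-valued continuous plurisubharmonic functions on `X`. -/
def PSHcR {n : ℕ} (X : Set (En n)) (u : En n → ℝ) : Prop :=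
  ContinuousOn u X ∧ PSHe X (fun x => (u x : EReal))

/-- `O_X`: the set of points `z ∈ X` whose only Jensen measure is `δ_z`. -/
def Oset {n : ℕ} (X : Set (En n)) : Set (En n) :=
  {z | z ∈ X ∧ ∀ μ : Measure (En n), IsJensen X z μ → μ = Measure.dirac z}

/-- The potential boundary `B_X`, the closure of `O_X`. -/
def Bset {n : ℕ} (X : Set (En n)) : Set (En n) := closure (Oset X)

/-- `J^b_z(X)`: Jensen measures with barycenter `z` supported on `B_X`. -/
def IsJensenB {n : ℕ} (X : Set (En n)) (z : En n) (μ : Measure (En n)) : Prop :=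
  IsJensen X z μ ∧ μ (Bset X)ᶜ = 0

/-- `ν` is subordinated to `μ` : `μ(u) ≥ ν(u)` for all `u ∈ PSH^c(X)`. -/
def Subord {n : ℕ} (X : Set (En n)) (μ ν : Measure (En n)) : Prop :=
  ∀ u : En n → EReal, PSHce X u → eint ν u ≤ eint μ u

/-- Subharmonic functions with values in `[-∞, ∞)` on an open set `U ⊆ ℂ`. -/
def SubharmOn (u : ℂ → EReal) (U : Set ℂ) : Prop :=
  UpperSemicontinuousOn u U ∧ (∀ z ∈ U, u z < ⊤) ∧
  ∀ z ∈ U, ∀ r : ℝ, 0 < r → closedBall z r ⊆ U →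
    u z ≤ eint thetaM (fun θ => u (circleMap z r θ))

/-- Harmonic (real-valued) functions on an open set `U ⊆ ℂ`: continuous functions
satisfying the mean-value equality. -/
def HarmOn (h : ℂ → ℝ) (U : Set ℂ) : Prop :=
  ContinuousOn h U ∧
  ∀ z ∈ U, ∀ r : ℝ, 0 < r → closedBall z r ⊆ U →
    h z = (2 * Real.pi)⁻¹ * ∫ θ in (0 : ℝ)..(2 * Real.pi), h (circleMap z r θ)

/-- Superharmonic (real-valued) functions on an open set `U ⊆ ℂ`. -/
def SuperharmOn (v : ℂ → ℝ) (U : Set ℂ) : Prop :=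
  LowerSemicontinuousOn v U ∧
  ∀ z ∈ U, ∀ r : ℝ, 0 < r → closedBall z r ⊆ U →
    (2 * Real.pi)⁻¹ * (∫ θ in (0 : ℝ)..(2 * Real.pi), v (circleMap z r θ)) ≤ v z

/-- The infimum of all positive superharmonic functions on the unit disk, extending
continuously to the closed disk and `≥ 1` on `A`, evaluated at `z`. -/
def hmPre (A : Set ℂ) (z : ℂ) : ℝ :=
  sInf {t : ℝ | ∃ v : ℂ → ℝ, SuperharmOn v (ball 0 1) ∧ (∀ w ∈ ball (0 : ℂ) 1, 0 < v w) ∧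
    ContinuousOn v (closedBall 0 1) ∧ (∀ w ∈ A, 1 ≤ v w) ∧ t = v z}

/-- The harmonic measure `ω(z, A, 𝔻)` of `A` with respect to the unit disk. -/
def hm (z : ℂ) (A : Set ℂ) : ℝ := Filter.liminf (fun w => hmPre A w) (𝓝 z)

open Classical in
/-- The radial limit of a map `f` at the boundary point `ζ` of the unit circle
(junk value `0` if the radial limit does not exist). -/
def bval {n : ℕ} (f : ℂ → En n) (ζ : ℂ) : En n :=
  if h : ∃ l : En n, Tendsto (fun r : ℝ => f ((r : ℂ) * ζ)) (𝓝[<] (1 : ℝ)) (𝓝 l)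
  then h.choose else 0

open Classical in
/-- The radial limit of an `EReal`-valued function on the disk at the boundary point `ζ`. -/
def bvalE (g : ℂ → EReal) (ζ : ℂ) : EReal :=
  if h : ∃ l : EReal, Tendsto (fun r : ℝ => g ((r : ℂ) * ζ)) (𝓝[<] (1 : ℝ)) (𝓝 l)
  then h.choose else 0

/-- `μ_f`: the push-forward of the normalized arclength measure on the unit circle under the
radial boundary values of `f`. -/
def bmeas {n : ℕ} (f : ℂ → En n) : Measure (En n) :=
  thetaM.map (fun θ => bval f (circleMap 0 1 θ))

/-- Weak-* convergence of a sequence of measures on `ℂⁿ`. -/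
def WeakConv {n : ℕ} (μs : ℕ → Measure (En n)) (μ : Measure (En n)) : Prop :=
  ∀ φ : BoundedContinuousFunction (En n) ℝ,
    Tendsto (fun j => ∫ x, φ x ∂(μs j)) atTop (𝓝 (∫ x, φ x ∂μ))

/-- The cluster set `cl L` of a sequence of maps of the unit disk into `ℂⁿ`. -/
def clusterSet {n : ℕ} (f : ℕ → ℂ → En n) : Set (En n) :=
  {z | ∀ r : ℝ, 0 < r → ∀ N : ℕ, ∃ j, N ≤ j ∧ ∃ ζ ∈ ball (0 : ℂ) 1, f j ζ ∈ ball z r}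

/-- A point `z` is totally essential for the sequence `f` if for every open set `V ∋ z` the
harmonic measures at `0` of `f j ⁻¹' V` stay bounded away from `0`. -/
def TotallyEssential {n : ℕ} (f : ℕ → ℂ → En n) (z : En n) : Prop :=
  ∀ V : Set (En n), IsOpen V → z ∈ V →
    0 < Filter.atTop.liminf (fun j => hm 0 ((f j ⁻¹' V) ∩ ball 0 1))

/-- A totally perfect sequence `L` of holomorphic maps of the unit disk into `ℂⁿ`: a
uniformly bounded sequence of holomorphic maps which is weak-* converging (with limit measure
`μ_L` and center `z_L`) and all of whose cluster points are totally essential. -/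
structure PerfectSeq (n : ℕ) where
  f : ℕ → ℂ → En n
  holo : ∀ j, DifferentiableOn ℂ (f j) (ball 0 1)
  bdd : ∃ C : ℝ, ∀ j, ∀ ζ ∈ ball (0 : ℂ) 1, ‖f j ζ‖ ≤ C
  μL : Measure (En n)
  conv : WeakConv (fun j => bmeas (f j)) μL
  zL : En n
  center : Tendsto (fun j => f j 0) atTop (𝓝 zL)
  ess : ∀ z ∈ clusterSet f, TotallyEssential f z

/-- `J_z^s(L)`: the measures obtained as weak-* limits of `μ_{f_{j_k} ∘ g_k}` for subsequences
`{j_k}` and holomorphic maps `g_k : 𝔻 → 𝔻` with `f_{j_k}(g_k(0)) → z`. -/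
def JsSet {n : ℕ} (L : PerfectSeq n) (z : En n) : Set (Measure (En n)) :=
  {μ | ∃ jk : ℕ → ℕ, StrictMono jk ∧ ∃ g : ℕ → ℂ → ℂ,
    (∀ k, DifferentiableOn ℂ (g k) (ball 0 1) ∧ MapsTo (g k) (ball 0 1) (ball 0 1)) ∧
    WeakConv (fun k => bmeas ((L.f (jk k)) ∘ (g k))) μ ∧
    Tendsto (fun k => L.f (jk k) (g k 0)) atTop (𝓝 z)}

/-- `J_z(L)`: the convex hull of `J_z^s(L)`. -/
def JLSet {n : ℕ} (L : PerfectSeq n) (z : En n) : Set (Measure (En n)) :=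
  {μ | ∃ (m : ℕ) (w : Fin m → ℝ) (ν : Fin m → Measure (En n)),
    (∀ i, 0 ≤ w i) ∧ (∑ i, w i = 1) ∧ (∀ i, ν i ∈ JsSet L z) ∧
    μ = ∑ i, (ENNReal.ofReal (w i)) • ν i}

/-- `u` is harmonic on the totally perfect sequence `L`. -/
def HarmonicOnL {n : ℕ} (L : PerfectSeq n) (u : En n → EReal) : Prop :=
  PSHce (clusterSet L.f) u ∧
  ∀ z ∈ clusterSet L.f, ∀ μ ∈ JLSet L z, eint μ u = u z

/-- `PSH^w(X)`: weakly plurisubharmonic functions, the upper envelopes of nonempty families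
of continuous plurisubharmonic functions on `X`. -/
def PSHw {n : ℕ} (X : Set (En n)) (u : En n → EReal) : Prop :=
  ∃ F : Set (En n → EReal), F.Nonempty ∧ (∀ v ∈ F, PSHce X v) ∧
    ∀ x ∈ X, u x = ⨆ v ∈ F, v x

/-- `u` is maximal on `X ∖ Z`: for every relatively open `V ⊆ X ∖ Z` and every
`v ∈ PSH^c(closure V)`, if `v ≤ u` on the relative boundary of `V` in `X` then `v ≤ u`
on `closure V`. -/
def MaximalOn {n : ℕ} (X Z : Set (En n)) (u : En n → EReal) : Prop :=
  ∀ W : Set (En n), IsOpen W → X ∩ W ⊆ X \ Z →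
    ∀ v : En n → EReal, PSHce (closure (X ∩ W)) v →
      (∀ x ∈ closure (X ∩ W) \ (X ∩ W), v x ≤ u x) →
      ∀ x ∈ closure (X ∩ W), v x ≤ u x

/-- Pluriharmonic continuous real-valued functions on `X`. -/
def Pluriharm {n : ℕ} (X : Set (En n)) (h : En n → ℝ) : Prop :=
  ContinuousOn h X ∧
  ∀ z ∈ X, ∀ μ : Measure (En n), IsJensen X z μ → (h z : EReal) = eint μ (fun x => (h x : EReal))

/-- `X` is a Poisson set: every continuous real-valued function on `B_X` extends to a
pluriharmonic function on `X`. -/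
def PoissonSet {n : ℕ} (X : Set (En n)) : Prop :=
  ∀ φ : En n → ℝ, ContinuousOn φ (Bset X) →
    ∃ h : En n → ℝ, Pluriharm X h ∧ ∀ w ∈ Bset X, h w = φ w

end

open scoped CompactlySupported in
/-- A maximal measure for the order induced by a convex cone of continuous functions containing
the constants, tested against a single function `ρ`. -/
lemma exists_measure_le_on_cone_of_maximal {K : Type*} [TopologicalSpace K] [CompactSpace K]
    [T2Space K] [MeasurableSpace K] [BorelSpace K] (m : Measure K) [IsProbabilityMeasure m]
    (N : ConvexCone ℝ C(K, ℝ)) (hN : ∀ c : ℝ, ContinuousMap.const K c ∈ N)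
    (ρ : C(K, ℝ)) (hρ : ρ ≠ 0) :
    ∃ l : Measure K, IsProbabilityMeasure l ∧ (∀ g ∈ N, ∫ x, g x ∂l ≤ ∫ x, g x ∂m) ∧
      ∀ ε : ℝ, 0 < ε → ∃ g ∈ N, ρ ≤ g ∧ ∫ x, g x ∂l ≤ ∫ x, ρ x ∂l + ε := by
  have hint : ∀ (f : C(K, ℝ)), Integrable f m := fun f =>
    f.continuous.integrable_of_hasCompactSupport (HasCompactSupport.of_compactSpace f)
  let S : C(K, ℝ) → Set ℝ := fun f => {t | ∃ g ∈ N, f ≤ g ∧ t = ∫ x, g x ∂m}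
  let p : C(K, ℝ) → ℝ := fun f => sInf (S f)
  have hlb : ∀ f, ∀ t ∈ S f, ∫ x, f x ∂m ≤ t := by
    rintro f t ⟨g, -, hfg, rfl⟩
    exact integral_mono (hint f) (hint g) hfg
  have hbdd : ∀ f, BddBelow (S f) := fun f => ⟨_, fun t ht => hlb f t ht⟩
  have hne : ∀ f, (S f).Nonempty := fun f =>
    ⟨_, ContinuousMap.const K ‖f‖, hN _, fun x => (le_abs_self _).trans (f.norm_coe_le_norm x), rfl⟩
  have ple : ∀ f, ∀ g ∈ N, f ≤ g → p f ≤ ∫ x, g x ∂m := fun f g hg hfg =>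
    csInf_le (hbdd f) ⟨g, hg, hfg, rfl⟩
  have plt : ∀ f c, p f < c → ∃ g ∈ N, f ≤ g ∧ ∫ x, g x ∂m < c := by
    intro f c hc
    obtain ⟨t, ⟨g, hg, hfg, rfl⟩, ht⟩ := exists_lt_of_csInf_lt (hne f) hc
    exact ⟨g, hg, hfg, ht⟩
  have pint : ∀ f, ∫ x, f x ∂m ≤ p f := fun f => le_csInf (hne f) (hlb f)
  have psmul_le : ∀ c : ℝ, 0 < c → ∀ f, p (c • f) ≤ c * p f := by
    intro c hc f
    rw [← div_le_iff₀' hc]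
    refine le_csInf (hne f) ?_
    rintro t ⟨g, hg, hfg, rfl⟩
    rw [div_le_iff₀' hc]
    refine (ple (c • f) (c • g) (N.smul_mem hc hg)
      (fun x => mul_le_mul_of_nonneg_left (hfg x) hc.le)).trans_eq ?_
    simpa using integral_const_mul c g
  have psmul : ∀ c : ℝ, 0 < c → ∀ f, p (c • f) = c * p f := by
    intro c hc f
    refine le_antisymm (psmul_le c hc f) ?_
    have h := psmul_le c⁻¹ (inv_pos.2 hc) (c • f)
    rw [inv_smul_smul₀ hc.ne'] at h
    calc c * p f ≤ c * (c⁻¹ * p (c • f)) := by gcongr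
      _ = p (c • f) := by field_simp
  have padd : ∀ f g, p (f + g) ≤ p f + p g := by
    intro f g
    refine le_of_forall_pos_lt_add fun ε hε => ?_
    obtain ⟨a, ha, hfa, ha'⟩ := plt f (p f + ε / 2) (by linarith)
    obtain ⟨b, hb, hgb, hb'⟩ := plt g (p g + ε / 2) (by linarith)
    have h := ple (f + g) (a + b) (N.add_mem ha hb) (add_le_add hfa hgb)
    have h2 : ∫ x, (a + b) x ∂m = ∫ x, a x ∂m + ∫ x, b x ∂m := integral_add (hint a) (hint b)
    linarith
  have pzero : p 0 = 0 := by
    refine le_antisymm ?_ ?_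
    · simpa using ple 0 (ContinuousMap.const K 0) (hN 0) (fun x => le_rfl)
    · simpa using pint 0
  obtain ⟨L, hL1, hL2⟩ := exists_extension_of_le_sublinear
    (LinearPMap.mkSpanSingleton (σ := RingHom.id ℝ) ρ (p ρ) hρ) p psmul padd (by
      rintro ⟨x, hx⟩
      obtain ⟨c, rfl⟩ := Submodule.mem_span_singleton.1 hx
      rw [LinearPMap.mkSpanSingleton'_apply]
      simp only [RingHom.id_apply, smul_eq_mul]
      rcases lt_trichotomy c 0 with hc | rfl | hc
      · have h1 := padd (c • ρ) ((-c) • ρ)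
        rw [psmul (-c) (by linarith), ← add_smul, add_neg_cancel, zero_smul, pzero] at h1
        linarith
      · simp [pzero]
      · exact (psmul c hc ρ).ge)
  have hLρ : L ρ = p ρ := by
    have := hL1 ⟨ρ, Submodule.mem_span_singleton_self ρ⟩
    rwa [LinearPMap.mkSpanSingleton_apply] at this
  have hLN : ∀ g ∈ N, L g ≤ ∫ x, g x ∂m := fun g hg => (hL2 g).trans (ple g g hg le_rfl)
  have hLpos : ∀ f : C(K, ℝ), 0 ≤ f → 0 ≤ L f := by
    intro f hf
    have h := (hL2 (-f)).trans (ple (-f) (ContinuousMap.const K 0) (hN 0)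
      (fun x => neg_nonpos.2 (hf x)))
    simpa using h
  let Λ : C_c(K, ℝ) →ₚ[ℝ] ℝ := PositiveLinearMap.mk₀
    { toFun f := L f.toContinuousMap
      map_add' f g := L.map_add f.toContinuousMap g.toContinuousMap
      map_smul' c f := L.map_smul c f.toContinuousMap }
    (fun f hf => hLpos f.toContinuousMap hf)
  let l := RealRMK.rieszMeasure Λ
  have hl : ∀ f : C(K, ℝ), ∫ x, f x ∂l = L f := fun f =>
    RealRMK.integral_rieszMeasure Λ ⟨f, HasCompactSupport.of_compactSpace f⟩
  have hl1 : L 1 = 1 := by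
    refine le_antisymm ?_ ?_
    · simpa using hLN _ (hN 1)
    · have h := hLN _ (hN (-1))
      have h2 : ContinuousMap.const K (-1 : ℝ) = -1 := by ext; simp
      rw [h2, map_neg] at h
      simp at h
      linarith
  refine ⟨l, ⟨?_⟩, fun g hg => (hl g).trans_le (hLN g hg), fun ε hε => ?_⟩
  · have h := hl 1
    rw [hl1] at h
    simp only [ContinuousMap.one_apply, integral_const, smul_eq_mul, mul_one] at h
    rw [Measure.real, ENNReal.toReal_eq_one_iff] at h
    exact h
  · obtain ⟨g, hg, hρg, h⟩ := plt ρ (p ρ + ε) (by linarith)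
    refine ⟨g, hg, hρg, ?_⟩
    have := hLN g hg
    rw [hl, hl, hLρ]
    linarith

lemma epos_eq_toENNReal (x : EReal) : epos x = x.toENNReal := by
  unfold epos EReal.toENNReal
  congr

lemma eint_mono_ae {α : Type*} [MeasurableSpace α] {μ : Measure α} {u v : α → EReal}
    (h : ∀ᵐ x ∂μ, u x ≤ v x) : eint μ u ≤ eint μ v := by
  unfold eint
  simp_rw [epos_eq_toENNReal]
  refine EReal.sub_le_sub ?_ ?_
  · exact EReal.coe_ennreal_le_coe_ennreal_iff.2
      (lintegral_mono_ae (h.mono fun x hx => EReal.toENNReal_le_toENNReal hx))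
  · exact EReal.coe_ennreal_le_coe_ennreal_iff.2
      (lintegral_mono_ae (h.mono fun x hx =>
        EReal.toENNReal_le_toENNReal (EReal.neg_le_neg_iff.2 hx)))

lemma eint_coe {α : Type*} [MeasurableSpace α] {μ : Measure α} {f : α → ℝ}
    (hf : Integrable f μ) : eint μ (fun x => (f x : EReal)) = ((∫ x, f x ∂μ : ℝ) : EReal) := by
  have h1 : ∀ g : α → ℝ, Integrable g μ →
      (((∫⁻ x, ENNReal.ofReal (g x) ∂μ).toReal : ℝ) : EReal)
        = ((∫⁻ x, ENNReal.ofReal (g x) ∂μ : ℝ≥0∞) : EReal) := fun g hg =>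
    EReal.coe_ennreal_toReal
      ((lintegral_mono fun x => Real.ofReal_le_enorm (g x)).trans_lt hg.2).ne
  rw [integral_eq_lintegral_pos_part_sub_lintegral_neg_part hf, EReal.coe_sub, h1 f hf,
    h1 (fun x => -f x) hf.neg]
  simp_rw [eint, epos_eq_toENNReal, ← EReal.coe_neg, EReal.real_coe_toENNReal]

lemma eint_comap_subtype {α : Type*} [MeasurableSpace α] {μ : Measure α} {s : Set α}
    (hs : MeasurableSet s) (hμ : μ sᶜ = 0) (u : α → EReal) :
    eint (μ.comap ((↑) : s → α)) (fun x => u x) = eint μ u := by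
  unfold eint
  rw [lintegral_subtype_comap hs (fun x => epos (u x)),
    lintegral_subtype_comap hs (fun x => epos (-u x)),
    Measure.restrict_eq_self_of_ae_mem (mem_ae_iff.2 hμ)]

/-- The truncation from below at level `-k` of a continuous function with values in `[-∞, ∞)`. -/
noncomputable def truncBelow {K : Type*} [TopologicalSpace K] (u : K → EReal) (hu : Continuous u)
    (hut : ∀ x, u x < ⊤) (k : ℕ) : C(K, ℝ) where
  toFun x := (max (u x) ((-(k : ℝ) : ℝ) : EReal)).toReal
  continuous_toFun := by
    refine EReal.continuousOn_toReal.comp_continuous (hu.max continuous_const) fun x => ?_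
    simp only [mem_compl_iff, mem_insert_iff, mem_singleton_iff, not_or]
    exact ⟨(lt_of_lt_of_le (EReal.bot_lt_coe _) (le_max_right _ _)).ne',
      (max_lt (hut x) (EReal.coe_lt_top _)).ne⟩

lemma coe_truncBelow {K : Type*} [TopologicalSpace K] (u : K → EReal) (hu : Continuous u)
    (hut : ∀ x, u x < ⊤) (k : ℕ) (x : K) :
    (truncBelow u hu hut k x : EReal) = max (u x) ((-(k : ℝ) : ℝ) : EReal) :=
  EReal.coe_toReal (max_lt (hut x) (EReal.coe_lt_top _)).ne
    (lt_of_lt_of_le (EReal.bot_lt_coe _) (le_max_right _ _)).ne'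

lemma le_eint_of_forall_le_truncBelow {K : Type*} [TopologicalSpace K] [CompactSpace K]
    [MeasurableSpace K] [BorelSpace K] (l : Measure K) [IsFiniteMeasure l]
    (u : K → EReal) (hu : Continuous u) (hut : ∀ x, u x < ⊤) (a : EReal)
    (ha : ∀ k, a ≤ ((∫ x, truncBelow u hu hut k x ∂l : ℝ) : EReal)) : a ≤ eint l u := by
  have hint : ∀ k, Integrable (truncBelow u hu hut k) l := fun k =>
    (truncBelow u hu hut k).continuous.integrable_of_hasCompactSupport
      (HasCompactSupport.of_compactSpace _)
  have hpos : ∀ k x, (truncBelow u hu hut k x : EReal).toENNReal = (u x).toENNReal := by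
    intro k x
    rw [coe_truncBelow]
    rcases le_total (u x) ((-(k : ℝ) : ℝ) : EReal) with h | h
    · have h0 : ((-(k : ℝ) : ℝ) : EReal) ≤ 0 := by
        rw [← EReal.coe_zero, EReal.coe_le_coe_iff]
        simp
      rw [max_eq_right h, EReal.toENNReal_of_nonpos h0, EReal.toENNReal_of_nonpos (h.trans h0)]
    · rw [max_eq_left h]
  have hA : (∫⁻ x, (u x).toENNReal ∂l) ≠ ⊤ := by
    simp_rw [← hpos 0, EReal.real_coe_toENNReal]
    exact ((lintegral_mono fun x => Real.ofReal_le_enorm _).trans_lt (hint 0).2).ne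
  have hB : Tendsto (fun k => ∫⁻ x, (-(truncBelow u hu hut k x : EReal)).toENNReal ∂l) atTop
      (𝓝 (∫⁻ x, (-(u x)).toENNReal ∂l)) := by
    refine lintegral_tendsto_of_tendsto_of_monotone (fun k => ?_) ?_ ?_
    · exact ((continuous_coe_real_ereal.comp
        (truncBelow u hu hut k).continuous).neg.measurable.ereal_toENNReal).aemeasurable
    · refine Eventually.of_forall fun x i j hij => EReal.toENNReal_le_toENNReal ?_
      rw [EReal.neg_le_neg_iff, coe_truncBelow, coe_truncBelow]
      refine max_le_max le_rfl ?_
      rw [EReal.coe_le_coe_iff]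
      simpa using hij
    · refine Eventually.of_forall fun x => ?_
      refine (EReal.continuous_toENNReal.tendsto _).comp ?_
      refine ((continuous_neg (G := EReal)).tendsto _).comp ?_
      simp_rw [coe_truncBelow]
      have h : Tendsto (fun k : ℕ => ((-(k : ℝ) : ℝ) : EReal)) atTop (𝓝 ⊥) :=
        EReal.tendsto_coe_nhds_bot_iff.2 (tendsto_neg_atTop_atBot.comp tendsto_natCast_atTop_atTop)
      simpa using (tendsto_const_nhds (x := u x)).max h
  have hlim : Tendsto (fun k => ((∫ x, truncBelow u hu hut k x ∂l : ℝ) : EReal)) atTop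
      (𝓝 (eint l u)) := by
    simp_rw [← eint_coe (hint _), eint, epos_eq_toENNReal, hpos, sub_eq_add_neg]
    refine (EReal.continuousAt_add (Or.inl ?_) (Or.inl ?_)).tendsto.comp
      (tendsto_const_nhds.prodMk_nhds (((continuous_neg (G := EReal)).tendsto _).comp
        ((continuous_coe_ennreal_ereal.tendsto _).comp hB)))
    · exact mt EReal.coe_ennreal_eq_top_iff.1 hA
    · exact EReal.coe_ennreal_ne_bot _
  exact ge_of_tendsto' hlim ha

lemma map_comap_subtype_of_compl_null {α : Type*} [MeasurableSpace α] {μ : Measure α} {s : Set α}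
    (hs : MeasurableSet s) (hμ : μ sᶜ = 0) :
    (μ.comap ((↑) : s → α)).map (↑) = μ := by
  rw [map_comap_subtype_coe hs, Measure.restrict_eq_self_of_ae_mem (mem_ae_iff.2 hμ)]

lemma comap_map_subtype {α : Type*} [MeasurableSpace α] {s : Set α} (hs : MeasurableSet s)
    (l : Measure s) : (l.map ((↑) : s → α)).comap (↑) = l :=
  (MeasurableEmbedding.subtype_coe hs).comap_map l

lemma isProbabilityMeasure_comap_subtype {α : Type*} [MeasurableSpace α] {μ : Measure α}
    [IsProbabilityMeasure μ] {s : Set α} (hs : MeasurableSet s) (hμ : μ sᶜ = 0) :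
    IsProbabilityMeasure (μ.comap ((↑) : s → α)) := by
  constructor
  have h := congrArg (fun m => m univ) (map_comap_subtype_of_compl_null hs hμ)
  simpa [Measure.map_apply measurable_subtype_coe] using h

lemma integrable_thetaM {f : ℝ → ℝ} (hf : Continuous f) : Integrable f thetaM := by
  refine Integrable.smul_measure ?_ ENNReal.ofReal_ne_top
  exact (hf.integrableOn_Icc (a := 0) (b := 2 * Real.pi)).mono_set Ico_subset_Icc_self

lemma integral_thetaM (f : ℝ → ℝ) :
    ∫ θ, f θ ∂thetaM = (2 * Real.pi)⁻¹ * ∫ θ in (0 : ℝ)..(2 * Real.pi), f θ := by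
  rw [thetaM, integral_smul_measure, ENNReal.toReal_ofReal (by positivity), smul_eq_mul,
    integral_Ico_eq_integral_Ioc, intervalIntegral.integral_of_le (by positivity)]

lemma integral_thetaM_re_add_mul_circleMap (a b : ℂ) (r : ℝ) :
    ∫ θ, (a + circleMap 0 r θ * b).re ∂thetaM = a.re := by
  have h : ∀ θ : ℝ, (a + circleMap 0 r θ * b).re
      = a.re + (r * b.re * Real.cos θ - r * b.im * Real.sin θ) := by
    intro θ
    simp [circleMap, Complex.exp_ofReal_mul_I_re, Complex.exp_ofReal_mul_I_im]
    ring
  simp_rw [h]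
  rw [integral_thetaM, intervalIntegral.integral_add (by simp)
    (Continuous.intervalIntegrable (by fun_prop) _ _), intervalIntegral.integral_sub
    (Continuous.intervalIntegrable (by fun_prop) _ _)
    (Continuous.intervalIntegrable (by fun_prop) _ _)]
  simp only [intervalIntegral.integral_const, intervalIntegral.integral_const_mul, integral_cos,
    integral_sin]
  simp
  field_simp

lemma continuous_coe_re_inner {n : ℕ} (z : En n) :
    Continuous (fun w : En n => (((inner ℂ z w).re : ℝ) : EReal)) :=
  continuous_coe_real_ereal.comp (Complex.continuous_re.comp (continuous_const.inner continuous_id))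

lemma pshOnE_re_inner {n : ℕ} (z : En n) :
    PshOnE (fun w : En n => (((inner ℂ z w).re : ℝ) : EReal)) univ := by
  refine ⟨(continuous_coe_re_inner z).upperSemicontinuous.upperSemicontinuousOn _,
    fun _ _ => EReal.coe_lt_top _, fun p _ w r _ _ => ?_⟩
  have hc : Continuous fun θ : ℝ => (inner ℂ z (p + circleMap 0 r θ • w)).re :=
    Complex.continuous_re.comp (continuous_const.inner
      (continuous_const.add ((continuous_circleMap 0 r).smul continuous_const)))
  rw [eint_coe (integrable_thetaM hc), EReal.coe_le_coe_iff]
  simp_rw [inner_add_right, inner_smul_right]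
  rw [integral_thetaM_re_add_mul_circleMap]

/-- The strictly positive exhaustion `1 + ‖x‖²`, restricted to `X`. -/
noncomputable def oneAddNormSq {n : ℕ} (X : Set (En n)) : C(X, ℝ) where
  toFun x := 1 + ‖(x : En n)‖ ^ 2
  continuous_toFun := by fun_prop

lemma IsJensen.le_integral_of_continuous {n : ℕ} {X : Set (En n)} (hX : IsCompact X) {z : En n}
    {σ : Measure (En n)} (hσ : IsJensen X z σ) (f : C(X, ℝ)) (g : En n → ℝ)
    (hfg : ∀ x : X, f x = g x) {a : EReal} (h : a ≤ eint σ (fun x => (g x : EReal))) :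
    a ≤ ((∫ x, f x ∂(σ.comap ((↑) : X → En n)) : ℝ) : EReal) := by
  have := hσ.1
  have : CompactSpace X := isCompact_iff_compactSpace.1 hX
  have := isProbabilityMeasure_comap_subtype hX.measurableSet hσ.2.1
  rw [← eint_comap_subtype hX.measurableSet hσ.2.1] at h
  simp_rw [← hfg] at h
  rwa [eint_coe (f.continuous.integrable_of_hasCompactSupport
    (HasCompactSupport.of_compactSpace _))] at h

lemma mem_Oset_of_integral_le {n : ℕ} {X : Set (En n)} (hX : IsCompact X) (z : X)
    (h : ∀ σ, IsJensen X z σ →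
      ∫ x, oneAddNormSq X x ∂(σ.comap ((↑) : X → En n)) ≤ oneAddNormSq X z) :
    (z : En n) ∈ Oset X := by
  refine ⟨z.2, fun σ hσ => ?_⟩
  have := hσ.1
  have : CompactSpace X := isCompact_iff_compactSpace.1 hX
  have := isProbabilityMeasure_comap_subtype hX.measurableSet hσ.2.1
  have hint : ∀ f : C(X, ℝ), Integrable f (σ.comap ((↑) : X → En n)) := fun f =>
    f.continuous.integrable_of_hasCompactSupport (HasCompactSupport.of_compactSpace _)
  let ℓ : C(X, ℝ) := ⟨fun x => (inner ℂ (z : En n) (x : En n)).re,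
    Complex.continuous_re.comp (continuous_const.inner continuous_subtype_val)⟩
  have h1 : ℓ z ≤ ∫ x, ℓ x ∂(σ.comap ((↑) : X → En n)) := by
    rw [← EReal.coe_le_coe_iff]
    exact hσ.le_integral_of_continuous hX ℓ _ (fun _ => rfl)
      (hσ.2.2 univ isOpen_univ (subset_univ _) _ (continuous_coe_re_inner _).continuousOn
        (pshOnE_re_inner _))
  have hℓz : ℓ z = ‖(z : En n)‖ ^ 2 := inner_self_eq_norm_sq (𝕜 := ℂ) (z : En n)
  let q : C(X, ℝ) := ⟨fun x => ‖(x : En n) - z‖ ^ 2, by fun_prop⟩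
  have hq : ∀ x, q x = oneAddNormSq X x - 2 * ℓ x + (‖(z : En n)‖ ^ 2 - 1) := by
    intro x
    have h2 := norm_sub_sq (𝕜 := ℂ) (x : En n) (z : En n)
    rw [inner_re_symm] at h2
    change ‖(x : En n) - z‖ ^ 2 = (1 + ‖(x : En n)‖ ^ 2)
      - 2 * (inner ℂ (z : En n) (x : En n)).re + (‖(z : En n)‖ ^ 2 - 1)
    rw [h2]
    simp only [RCLike.re_to_complex]
    ring
  have hq0 : ∫ x, q x ∂(σ.comap ((↑) : X → En n)) = 0 := by
    refine le_antisymm ?_ (integral_nonneg fun x => sq_nonneg _)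
    simp_rw [hq]
    rw [integral_add (f := fun x => oneAddNormSq X x - 2 * ℓ x)
      ((hint (oneAddNormSq X)).sub ((hint ℓ).const_mul 2)) (integrable_const _),
      integral_sub (hint (oneAddNormSq X)) ((hint ℓ).const_mul 2), integral_const_mul]
    have h3 := h σ hσ
    have h4 : oneAddNormSq X z = 1 + ‖(z : En n)‖ ^ 2 := rfl
    simp only [integral_const, probReal_univ, one_smul]
    linarith
  rw [integral_eq_zero_iff_of_nonneg (f := q) (fun x => sq_nonneg _) (hint q)] at hq0
  have hae : ((↑) : X → En n) =ᵐ[σ.comap ((↑) : X → En n)] fun _ => (z : En n) := by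
    filter_upwards [hq0] with x hx
    have : ‖(x : En n) - z‖ ^ 2 = 0 := hx
    exact sub_eq_zero.1 (norm_eq_zero.1 (pow_eq_zero_iff two_ne_zero |>.1 this))
  rw [← map_comap_subtype_of_compl_null hX.measurableSet hσ.2.1, Measure.map_congr hae,
    Measure.map_const]
  simp

/-- The cone of continuous functions on `X` that are superaveraging for all Jensen measures. -/
def superaveragingCone {n : ℕ} (X : Set (En n)) (hX : IsCompact X) : ConvexCone ℝ C(X, ℝ) where
  carrier := {g | ∀ z : X, ∀ σ, IsJensen X z σ → ∫ x, g x ∂(σ.comap ((↑) : X → En n)) ≤ g z}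
  smul_mem' c hc g hg z σ hσ := by
    simp only [ContinuousMap.coe_smul, Pi.smul_apply, integral_smul]
    exact smul_le_smul_of_nonneg_left (hg z σ hσ) hc.le
  add_mem' f hf g hg z σ hσ := by
    have := hσ.1
    have : CompactSpace X := isCompact_iff_compactSpace.1 hX
    have := isProbabilityMeasure_comap_subtype hX.measurableSet hσ.2.1
    have hint : ∀ f : C(X, ℝ), Integrable f (σ.comap ((↑) : X → En n)) := fun f =>
      f.continuous.integrable_of_hasCompactSupport (HasCompactSupport.of_compactSpace _)
    simp only [ContinuousMap.add_apply]
    rw [integral_add (hint f) (hint g)]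
    exact add_le_add (hf z σ hσ) (hg z σ hσ)

lemma const_mem_superaveragingCone {n : ℕ} (X : Set (En n)) (hX : IsCompact X) (c : ℝ) :
    ContinuousMap.const X c ∈ superaveragingCone X hX := by
  intro z σ hσ
  have := hσ.1
  have := isProbabilityMeasure_comap_subtype hX.measurableSet hσ.2.1
  simp

lemma PSHce.continuous_domRestrict {n : ℕ} {X : Set (En n)} {u : En n → EReal}
    (hu : PSHce X u) : Continuous fun x : X => u x :=
  continuousOn_iff_continuous_domRestrict.1 hu.2

lemma PSHce.lt_top {n : ℕ} {X : Set (En n)} {u : En n → EReal} (hu : PSHce X u) (x : X) :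
    u x < ⊤ :=
  hu.1.2.1 x x.2

lemma neg_truncBelow_mem_superaveragingCone {n : ℕ} {X : Set (En n)} (hX : IsCompact X)
    {u : En n → EReal} (hu : PSHce X u) (k : ℕ) :
    -truncBelow (fun x : X => u x) hu.continuous_domRestrict hu.lt_top k
      ∈ superaveragingCone X hX := by
  intro z σ hσ
  have := hσ.1
  have : CompactSpace X := isCompact_iff_compactSpace.1 hX
  have := isProbabilityMeasure_comap_subtype hX.measurableSet hσ.2.1
  set v := truncBelow (fun x : X => u x) hu.continuous_domRestrict hu.lt_top k with hv
  have hint : Integrable v (σ.comap ((↑) : X → En n)) :=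
    v.continuous.integrable_of_hasCompactSupport (HasCompactSupport.of_compactSpace _)
  have hcoe : ∀ x, (v x : EReal) = max (u x) ((-(k : ℝ) : ℝ) : EReal) := coe_truncBelow _ _ _ k
  have h : v z ≤ ∫ x, v x ∂(σ.comap ((↑) : X → En n)) := by
    rw [← EReal.coe_le_coe_iff, hcoe, max_le_iff]
    constructor
    · refine (hu.1.2.2 z z.2 σ hσ).trans ?_
      rw [← eint_comap_subtype hX.measurableSet hσ.2.1, ← eint_coe hint]
      refine eint_mono_ae (Eventually.of_forall fun x => ?_)
      rw [hcoe]
      exact le_max_left _ _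
    · rw [EReal.coe_le_coe_iff]
      have h2 := integral_mono (integrable_const (-(k : ℝ))) hint (fun x => by
        rw [← EReal.coe_le_coe_iff, hcoe]
        exact le_max_right _ _)
      simpa using h2
  simp only [ContinuousMap.neg_apply, integral_neg]
  exact neg_le_neg h

lemma ae_integral_le_of_cone {n : ℕ} {X : Set (En n)} (hX : IsCompact X) (l : Measure X)
    [IsProbabilityMeasure l] (ρ : C(X, ℝ))
    (h : ∀ ε : ℝ, 0 < ε → ∃ g ∈ superaveragingCone X hX, ρ ≤ g ∧
      ∫ x, g x ∂l ≤ ∫ x, ρ x ∂l + ε) :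
    ∀ᵐ (z : X) ∂l, ∀ σ, IsJensen X (z : En n) σ →
      ∫ x, ρ x ∂(σ.comap ((↑) : X → En n)) ≤ ρ z := by
  have : CompactSpace X := isCompact_iff_compactSpace.1 hX
  have hint : ∀ f : C(X, ℝ), Integrable f l := fun f =>
    f.continuous.integrable_of_hasCompactSupport (HasCompactSupport.of_compactSpace _)
  choose g hgN hρg hgl using fun k : ℕ => h (1 / ((k : ℝ) + 1)) (by positivity)
  have hzero : ∫⁻ z, ⨅ k, ENNReal.ofReal (g k z - ρ z) ∂l = 0 := by
    refine le_antisymm (ENNReal.le_of_forall_pos_le_add fun ε hε _ => ?_) zero_le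
    obtain ⟨k, hk⟩ := exists_nat_one_div_lt hε
    calc ∫⁻ z, ⨅ k, ENNReal.ofReal (g k z - ρ z) ∂l
        ≤ ∫⁻ z, ENNReal.ofReal (g k z - ρ z) ∂l := lintegral_mono fun z => iInf_le _ k
      _ = ENNReal.ofReal (∫ z, (g k z - ρ z) ∂l) :=
        (ofReal_integral_eq_lintegral_ofReal ((hint _).sub (hint _))
          (Eventually.of_forall fun z => sub_nonneg.2 (hρg k z))).symm
      _ ≤ ENNReal.ofReal ε := by
        refine ENNReal.ofReal_le_ofReal ?_
        rw [integral_sub (hint _) (hint _)]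
        have hk' : 1 / ((k : ℝ) + 1) < ε := by exact_mod_cast hk
        linarith [hgl k]
      _ = 0 + ε := by simp
  have hmeas : Measurable fun z => ⨅ k, ENNReal.ofReal (g k z - ρ z) :=
    .iInf fun k => ((g k).continuous.sub ρ.continuous).measurable.ennreal_ofReal
  rw [lintegral_eq_zero_iff hmeas] at hzero
  filter_upwards [hzero] with z hz σ hσ
  have := hσ.1
  have := isProbabilityMeasure_comap_subtype hX.measurableSet hσ.2.1
  refine le_of_forall_pos_lt_add fun ε hε => ?_
  have hz' : ⨅ k, ENNReal.ofReal (g k z - ρ z) < ENNReal.ofReal ε := by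
    simpa [hz] using hε
  obtain ⟨k, hk⟩ := iInf_lt_iff.1 hz'
  rw [ENNReal.ofReal_lt_ofReal_iff hε] at hk
  have h1 : ∫ x, ρ x ∂(σ.comap ((↑) : X → En n)) ≤ ∫ x, g k x ∂(σ.comap ((↑) : X → En n)) :=
    integral_mono
      (ρ.continuous.integrable_of_hasCompactSupport (HasCompactSupport.of_compactSpace _))
      ((g k).continuous.integrable_of_hasCompactSupport (HasCompactSupport.of_compactSpace _))
      (hρg k)
  linarith [hgN k z σ hσ]

lemma PshOnE.pshce {n : ℕ} {X U : Set (En n)} (hU : IsOpen U) (hXU : X ⊆ U) {u : En n → EReal}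
    (huc : ContinuousOn u U) (hu : PshOnE u U) : PSHce X u :=
  ⟨⟨hu.1.mono hXU, fun z hz => hu.2.1 z (hXU hz), fun _ _ _ hσ => hσ.2.2 U hU hXU u huc hu⟩,
    huc.mono hXU⟩

/-- Theorem 3.3: every Jensen measure is subordinated to a Jensen measure supported
on the potential boundary `B_X`. -/
theorem stmt_4 {n : ℕ} (X : Set (En n)) (hX : IsCompact X) (z0 : En n) (hz0 : z0 ∈ X)
    (μ : Measure (En n)) (hμ : IsJensen X z0 μ) :
    ∃ ν : Measure (En n), IsJensenB X z0 ν ∧ Subord X ν μ := by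
  have := hμ.1
  have hXm := hX.measurableSet
  have : CompactSpace X := isCompact_iff_compactSpace.1 hX
  have := isProbabilityMeasure_comap_subtype hXm hμ.2.1
  have hρ : oneAddNormSq X ≠ 0 := fun h => by
    have h1 : 1 + ‖z0‖ ^ 2 = 0 := congrArg (fun f : C(X, ℝ) => f ⟨z0, hz0⟩) h
    nlinarith [sq_nonneg ‖z0‖]
  obtain ⟨l, hl, hlN, hlρ⟩ := exists_measure_le_on_cone_of_maximal
    (μ.comap ((↑) : X → En n)) (superaveragingCone X hX) (const_mem_superaveragingCone X hX)
    (oneAddNormSq X) hρ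
  have hlX : l.map ((↑) : X → En n) Xᶜ = 0 := by
    rw [Measure.map_apply measurable_subtype_coe hXm.compl]
    simp
  have hsub : Subord X (l.map (↑)) μ := by
    intro u hu
    rw [← eint_comap_subtype hXm hlX, ← eint_comap_subtype hXm hμ.2.1, comap_map_subtype hXm]
    refine le_eint_of_forall_le_truncBelow l _ hu.continuous_domRestrict hu.lt_top _
      fun k => ?_
    have h := hlN _ (neg_truncBelow_mem_superaveragingCone hX hu k)
    simp only [ContinuousMap.neg_apply, integral_neg, neg_le_neg_iff] at h
    refine le_trans ?_ (EReal.coe_le_coe_iff.2 h)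
    rw [← eint_coe ((ContinuousMap.continuous _).integrable_of_hasCompactSupport
      (HasCompactSupport.of_compactSpace _))]
    refine eint_mono_ae (Eventually.of_forall fun x => ?_)
    rw [coe_truncBelow]
    exact le_max_left _ _
  refine ⟨l.map (↑), ⟨⟨Measure.isProbabilityMeasure_map measurable_subtype_coe.aemeasurable, hlX,
    fun U hU hXU u huc hu => ?_⟩, ?_⟩, hsub⟩
  · exact (hμ.2.2 U hU hXU u huc hu).trans (hsub u (hu.pshce hU hXU huc))
  · have hB : MeasurableSet (Bset X) := isClosed_closure.measurableSet
    rw [Measure.map_apply measurable_subtype_coe hB.compl, measure_eq_zero_iff_ae_notMem]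
    filter_upwards [ae_integral_le_of_cone hX l (oneAddNormSq X) hlρ] with z hz
    exact not_not.2 (subset_closure (mem_Oset_of_integral_le hX z hz))
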